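/- Let q be a real-valued locally integrable function on ℝ, let M = ψ(−1,0,q) be the associated solution matrix with entries a = C_{1,q}, b = S_{q,1}, c = S_{1,q}, d = C_{q,1}, and let Σ = { −d(x)/c(x) : x ∈ ℝ, c(x) ≠ 0 } be the singular curve. Then Σ ⊆ ℝ, and if Σ ≠ ℝ then ℝ \ Σ is an interval (i.e., a connected subset of ℝ). -/

import Mathlib

open MeasureTheory intervalIntegral Filter

noncomputable section

/-- Alternating product f(s1)g(s2)f(s3)⋯ with j factors (index 0 ↦ f). -/
def altProd (f g : ℝ → ℂ) (j : ℕ) (s : Fin j → ℝ) : ℂ :=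
  ∏ i : Fin j, if (i : ℕ) % 2 = 0 then f (s i) else g (s i)

/-- The signed simplex integral A_j(f,g,x). -/
def simplexA (f g : ℝ → ℂ) (j : ℕ) (x : ℝ) : ℂ :=
  if 0 ≤ x then
    ∫ s in {s : Fin j → ℝ | StrictMono s ∧ ∀ i, s i ∈ Set.Ioo 0 x}, altProd f g j s
  else
    (-1 : ℂ) ^ j *
      ∫ s in {s : Fin j → ℝ | StrictAnti s ∧ ∀ i, s i ∈ Set.Ioo x 0}, altProd f g j s

/-- The bivariate exponential E_{f,g}. -/
def bivE (f g : ℝ → ℂ) (x : ℝ) : ℂ := 1 + ∑' j : ℕ, simplexA f g (j + 1) x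

def bivC (f g : ℝ → ℂ) (x : ℝ) : ℂ := (bivE f g x + bivE (-f) (-g) x) / 2

def bivS (f g : ℝ → ℂ) (x : ℝ) : ℂ := (bivE f g x - bivE (-f) (-g) x) / 2

/-- Locally absolutely continuous complex-valued function on ℝ. -/
def LocAC (F : ℝ → ℂ) : Prop :=
  ∃ F' : ℝ → ℂ, LocallyIntegrable F' volume ∧
    ∀ x : ℝ, F x = F 0 + ∫ t in (0:ℝ)..x, F' t

end

section
open Set

theorem strictMono_snoc_mem_Ioo_iff {j : ℕ} (x t : ℝ) (u : Fin j → ℝ) :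
    (StrictMono (Fin.snoc u t : Fin (j + 1) → ℝ) ∧
        ∀ i, (Fin.snoc u t : Fin (j + 1) → ℝ) i ∈ Ioo 0 x) ↔
      t ∈ Ioo 0 x ∧ StrictMono u ∧ ∀ i, u i ∈ Ioo 0 t := by
  constructor
  · rintro ⟨hm, hi⟩
    refine ⟨by simpa using hi (Fin.last j), fun a b hab => ?_, fun i => ⟨?_, ?_⟩⟩
    · simpa using hm (Fin.castSucc_lt_castSucc_iff.2 hab)
    · simpa using (hi i.castSucc).1
    · simpa using hm (Fin.castSucc_lt_last i)
  · rintro ⟨ht, hm, hi⟩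
    refine ⟨fun a b hab => ?_, fun i => ?_⟩
    · induction b using Fin.lastCases with
      | last =>
        induction a using Fin.lastCases with
        | last => exact absurd hab (lt_irrefl _)
        | cast a => simpa using (hi a).2
      | cast b =>
        induction a using Fin.lastCases with
        | last => exact absurd hab (not_lt.2 (Fin.le_last _))
        | cast a => simpa using hm (Fin.castSucc_lt_castSucc_iff.1 hab)
    · induction i using Fin.lastCases with
      | last => simpa using ht
      | cast i => simpa using ⟨(hi i).1, (hi i).2.trans ht.2⟩

theorem altProd_snoc (f g : ℝ → ℂ) (j : ℕ) (u : Fin j → ℝ) (t : ℝ) :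
    altProd f g (j + 1) (Fin.snoc u t) =
      (if j % 2 = 0 then f t else g t) * altProd f g j u := by
  simp [altProd, Fin.prod_univ_castSucc, mul_comm]

theorem measurableSet_strictMono_mem_Ioo (j : ℕ) (x : ℝ) :
    MeasurableSet {s : Fin j → ℝ | StrictMono s ∧ ∀ i, s i ∈ Ioo 0 x} := by
  have : {s : Fin j → ℝ | StrictMono s ∧ ∀ i, s i ∈ Ioo 0 x} =
      (⋂ a, ⋂ b, ⋂ _ : a < b, {s : Fin j → ℝ | s a < s b}) ∩
        ⋂ i, {s : Fin j → ℝ | s i ∈ Ioo 0 x} := by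
    ext s
    simp [StrictMono]
  rw [this]
  refine MeasurableSet.inter (MeasurableSet.iInter fun a => MeasurableSet.iInter fun b =>
    MeasurableSet.iInter fun _ => measurableSet_lt (by fun_prop) (by fun_prop))
    (MeasurableSet.iInter fun i => ?_)
  exact measurableSet_Ioo.preimage (measurable_pi_apply i)

theorem integrableOn_altProd {f g : ℝ → ℂ} (hf : LocallyIntegrable f volume)
    (hg : LocallyIntegrable g volume) (j : ℕ) (x : ℝ) :
    IntegrableOn (altProd f g j) {s : Fin j → ℝ | StrictMono s ∧ ∀ i, s i ∈ Ioo 0 x} := by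
  have hf' : IntegrableOn f (Ioo 0 x) :=
    (hf.integrableOn_isCompact isCompact_Icc).mono_set Ioo_subset_Icc_self
  have hg' : IntegrableOn g (Ioo 0 x) :=
    (hg.integrableOn_isCompact isCompact_Icc).mono_set Ioo_subset_Icc_self
  have : IntegrableOn (altProd f g j) (Set.pi univ fun _ : Fin j => Ioo 0 x) := by
    unfold IntegrableOn altProd
    rw [volume_pi, Measure.restrict_pi_pi]
    refine Integrable.fintype_prod_dep
      (f := fun (i : Fin j) t => if (i : ℕ) % 2 = 0 then f t else g t) fun i => ?_
    split_ifs
    exacts [hf', hg']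
  exact this.mono_set fun s hs i _ => hs.2 i

theorem setIntegral_altProd_succ {f g : ℝ → ℂ} (hf : LocallyIntegrable f volume)
    (hg : LocallyIntegrable g volume) (j : ℕ) (x : ℝ) :
    ∫ s in {s : Fin (j + 1) → ℝ | StrictMono s ∧ ∀ i, s i ∈ Ioo 0 x}, altProd f g (j + 1) s =
      ∫ t in Ioo 0 x, (if j % 2 = 0 then f t else g t) *
        ∫ s in {s : Fin j → ℝ | StrictMono s ∧ ∀ i, s i ∈ Ioo 0 t}, altProd f g j s := by
  set S := {s : Fin (j + 1) → ℝ | StrictMono s ∧ ∀ i, s i ∈ Ioo 0 x} with hS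
  have hSm : MeasurableSet S := measurableSet_strictMono_mem_Ioo _ _
  have hint : Integrable (S.indicator (altProd f g (j + 1))) volume :=
    (integrable_indicator_iff hSm).2 (integrableOn_altProd hf hg _ _)
  have he := (volume_preserving_piFinSuccAbove (fun _ : Fin (j + 1) => ℝ) (Fin.last j)).symm
  rw [← MeasureTheory.integral_indicator hSm,
    ← he.integral_comp' (S.indicator (altProd f g (j + 1))),
    Measure.volume_eq_prod, integral_prod, ← MeasureTheory.integral_indicator measurableSet_Ioo]
  · refine integral_congr_ae (Eventually.of_forall fun t => ?_)
    have key : ∀ u : Fin j → ℝ, S.indicator (altProd f g (j + 1))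
        ((MeasurableEquiv.piFinSuccAbove (fun _ : Fin (j + 1) => ℝ) (Fin.last j)).symm (t, u)) =
        (Ioo 0 x).indicator (fun t => (if j % 2 = 0 then f t else g t) *
          {s : Fin j → ℝ | StrictMono s ∧ ∀ i, s i ∈ Ioo 0 t}.indicator (altProd f g j) u) t := by
      intro u
      have hu : (MeasurableEquiv.piFinSuccAbove (fun _ : Fin (j + 1) => ℝ) (Fin.last j)).symm
          (t, u) = (Fin.snoc u t : Fin (j + 1) → ℝ) := by
        simp [MeasurableEquiv.piFinSuccAbove, Fin.snocEquiv]
      rw [hu]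
      have hmem := strictMono_snoc_mem_Ioo_iff x t u
      classical
      simp only [indicator_apply, hS, mem_ofPred_eq, hmem, altProd_snoc]
      by_cases h1 : t ∈ Ioo 0 x <;>
        by_cases h2 : StrictMono u ∧ ∀ i, u i ∈ Ioo 0 t <;> simp [h1, h2]
    simp only [key]
    by_cases ht : t ∈ Ioo 0 x
    · simp only [indicator_of_mem ht]
      rw [MeasureTheory.integral_const_mul,
        MeasureTheory.integral_indicator (measurableSet_strictMono_mem_Ioo _ _)]
    · simp [indicator_of_notMem ht]
  · exact (he.integrable_comp_emb (MeasurableEquiv.measurableEmbedding _)).2 hint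

theorem simplexA_of_nonneg (f g : ℝ → ℂ) (j : ℕ) {x : ℝ} (hx : 0 ≤ x) :
    simplexA f g j x =
      ∫ s in {s : Fin j → ℝ | StrictMono s ∧ ∀ i, s i ∈ Ioo 0 x}, altProd f g j s :=
  if_pos hx

theorem simplexA_of_nonpos (f g : ℝ → ℂ) (j : ℕ) {x : ℝ} (hx : x ≤ 0) :
    simplexA f g j x =
      (-1) ^ j * simplexA (fun t => f (-t)) (fun t => g (-t)) j (-x) := by
  rcases hx.eq_or_lt with rfl | hx
  · rcases j with _ | j
    · simp [simplexA, altProd]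
    · simp [simplexA]
  · rw [simplexA_of_nonneg _ _ _ (neg_nonneg.2 hx.le), simplexA, if_neg (not_le.2 hx)]
    congr 1
    have hm : MeasurableSet {s : Fin j → ℝ | StrictAnti s ∧ ∀ i, s i ∈ Ioo x 0} := by
      convert! (measurableSet_strictMono_mem_Ioo j (-x)).preimage
        (measurable_neg (G := Fin j → ℝ)) using 1
      ext s
      simp only [mem_preimage, mem_ofPred_eq, Pi.neg_apply, mem_Ioo, StrictMono, StrictAnti,
        neg_lt_neg_iff, Left.neg_pos_iff, and_comm (a := x < _)]
    rw [← MeasureTheory.integral_indicator hm,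
      ← MeasureTheory.integral_indicator (measurableSet_strictMono_mem_Ioo _ _),
      ← integral_neg_eq_self]
    refine integral_congr_ae (Eventually.of_forall fun s => ?_)
    classical
    simp only [indicator_apply, mem_ofPred_eq, Pi.neg_apply, mem_Ioo, StrictMono, StrictAnti,
      neg_lt_neg_iff, Left.neg_neg_iff, altProd, and_comm (a := x < _), lt_neg (a := x)]

theorem simplexA_zero (f g : ℝ → ℂ) (x : ℝ) : simplexA f g 0 x = 1 := by
  simp [simplexA, altProd, StrictMono, StrictAnti, Measure.real, volume_pi]

theorem simplexA_succ {f g : ℝ → ℂ} (hf : LocallyIntegrable f volume)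
    (hg : LocallyIntegrable g volume) (j : ℕ) (x : ℝ) :
    simplexA f g (j + 1) x =
      ∫ t in (0 : ℝ)..x, (if j % 2 = 0 then f t else g t) * simplexA f g j t := by
  have pos : ∀ {f g : ℝ → ℂ}, LocallyIntegrable f volume → LocallyIntegrable g volume →
      ∀ {x : ℝ}, 0 ≤ x → simplexA f g (j + 1) x =
      ∫ t in (0 : ℝ)..x, (if j % 2 = 0 then f t else g t) * simplexA f g j t := by
    intro f g hf hg x hx
    rw [simplexA_of_nonneg _ _ _ hx, setIntegral_altProd_succ hf hg,
      intervalIntegral.integral_of_le hx, integral_Ioc_eq_integral_Ioo]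
    refine setIntegral_congr_fun measurableSet_Ioo fun t ht => ?_
    simp only [simplexA_of_nonneg f g j ht.1.le]
  rcases le_total 0 x with hx | hx
  · exact pos hf hg hx
  · have hneg : ∀ {f : ℝ → ℂ}, LocallyIntegrable f volume →
        LocallyIntegrable (fun t => f (-t)) volume := by
      intro f hf
      refine (locallyIntegrable_map_homeomorph (Homeomorph.neg ℝ)).1 ?_
      rwa [Homeomorph.coe_neg, Measure.map_neg_eq_self]
    rw [simplexA_of_nonpos _ _ _ hx, pos (hneg hf) (hneg hg) (by linarith)]
    have h := intervalIntegral.integral_comp_neg (a := 0) (b := -x) fun t =>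
      (if j % 2 = 0 then f t else g t) *
        simplexA (fun t => f (-t)) (fun t => g (-t)) j (-t)
    simp only [neg_neg, neg_zero] at h
    rw [h, intervalIntegral.integral_symm x 0, pow_succ, mul_neg_one, neg_mul, neg_inj,
      ← intervalIntegral.integral_const_mul]
    refine intervalIntegral.integral_congr fun t ht => ?_
    rw [uIcc_of_le hx] at ht
    simp only [simplexA_of_nonpos f g j ht.2]
    ring

/-- The primitives from `0` of `1`, iterated with the alternating weights `f, g, f, …`. -/
noncomputable def iterPrim (f g : ℝ → ℝ) : ℕ → ℝ → ℝ
  | 0 => fun _ => 1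
  | n + 1 => fun x => ∫ t in (0 : ℝ)..x, (if n % 2 = 0 then f t else g t) * iterPrim f g n t

theorem locallyIntegrable_ofReal {f : ℝ → ℝ} (hf : LocallyIntegrable f volume) :
    LocallyIntegrable (fun x => (f x : ℂ)) volume := fun x =>
  let ⟨s, hs, h⟩ := hf x
  ⟨s, hs, h.ofReal⟩

theorem locallyIntegrable_abs {f : ℝ → ℝ} (hf : LocallyIntegrable f volume) :
    LocallyIntegrable (fun x => |f x|) volume := fun x =>
  let ⟨s, hs, h⟩ := hf x
  ⟨s, hs, h.abs⟩

theorem locallyIntegrable_mul_continuous {f u : ℝ → ℝ} (hf : LocallyIntegrable f volume)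
    (hu : Continuous u) : LocallyIntegrable (fun t => f t * u t) volume := by
  refine locallyIntegrable_iff.2 fun K hK => ?_
  exact (hf.integrableOn_isCompact hK).mul_continuousOn hu.continuousOn hK

theorem locallyIntegrable_intervalIntegrable {f : ℝ → ℝ} (hf : LocallyIntegrable f volume)
    (a b : ℝ) : IntervalIntegrable f volume a b :=
  (hf.integrableOn_isCompact isCompact_uIcc).intervalIntegrable

theorem continuous_primitive_of_locallyIntegrable {f : ℝ → ℝ}
    (hf : LocallyIntegrable f volume) : Continuous fun x => ∫ t in (0 : ℝ)..x, f t :=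
  intervalIntegral.continuous_primitive (locallyIntegrable_intervalIntegrable hf) 0

theorem simplexA_ofReal {f g : ℝ → ℝ} (hf : LocallyIntegrable f volume)
    (hg : LocallyIntegrable g volume) (j : ℕ) (x : ℝ) :
    simplexA (fun t => (f t : ℂ)) (fun t => (g t : ℂ)) j x = iterPrim f g j x := by
  induction j generalizing x with
  | zero => simp [simplexA_zero, iterPrim]
  | succ j ih =>
    rw [simplexA_succ (locallyIntegrable_ofReal hf) (locallyIntegrable_ofReal hg), iterPrim,
      ← intervalIntegral.integral_ofReal]
    refine intervalIntegral.integral_congr fun t _ => ?_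
    simp only [ih]
    split_ifs <;> push_cast <;> rfl

theorem iterPrim_neg (f g : ℝ → ℝ) (j : ℕ) (x : ℝ) :
    iterPrim (-f) (-g) j x = (-1) ^ j * iterPrim f g j x := by
  induction j generalizing x with
  | zero => simp [iterPrim]
  | succ j ih =>
    rw [iterPrim, iterPrim, ← intervalIntegral.integral_const_mul]
    refine intervalIntegral.integral_congr fun t _ => ?_
    simp only [ih, Pi.neg_apply]
    split_ifs <;> ring

theorem continuous_iterPrim {f g : ℝ → ℝ} (hf : LocallyIntegrable f volume)
    (hg : LocallyIntegrable g volume) (j : ℕ) : Continuous (iterPrim f g j) := by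
  induction j with
  | zero => exact continuous_const
  | succ j ih =>
    refine continuous_primitive_of_locallyIntegrable (locallyIntegrable_mul_continuous ?_ ih)
    split_ifs
    exacts [hf, hg]

theorem mul_eq_add_integral_of_eq_add_integral {f g F G : ℝ → ℝ} {F₀ G₀ : ℝ}
    (hf : LocallyIntegrable f volume) (hg : LocallyIntegrable g volume)
    (hF : ∀ x, F x = F₀ + ∫ t in (0 : ℝ)..x, f t) (hG : ∀ x, G x = G₀ + ∫ t in (0 : ℝ)..x, g t)
    (x : ℝ) : F x * G x = F₀ * G₀ + ∫ t in (0 : ℝ)..x, (f t * G t + F t * g t) := by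
  have key : ∀ {f F : ℝ → ℝ} {F₀ : ℝ}, LocallyIntegrable f volume →
      (∀ x, F x = F₀ + ∫ t in (0 : ℝ)..x, f t) →
      AbsolutelyContinuousOnInterval F 0 x ∧ ∀ᵐ t, deriv F t = f t := by
    intro f F F₀ hf hF
    obtain rfl : F = fun x => F₀ + ∫ t in (0 : ℝ)..x, f t := funext hF
    constructor
    · have hc : AbsolutelyContinuousOnInterval (fun _ : ℝ => F₀) 0 x :=
        (LipschitzWith.const F₀).lipschitzOnWith.absolutelyContinuousOnInterval
      exact hc.fun_add ((locallyIntegrable_intervalIntegrable hf 0 x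
        ).absolutelyContinuousOnInterval_intervalIntegral left_mem_uIcc)
    · filter_upwards [LocallyIntegrable.ae_hasDerivAt_integral hf] with t ht
      exact ((ht 0).const_add F₀).deriv
  obtain ⟨hFa, hFd⟩ := key hf hF
  obtain ⟨hGa, hGd⟩ := key hg hG
  have h := hFa.integral_deriv_mul_eq_sub hGa
  have h0 : F 0 = F₀ := by simp [hF]
  have h0' : G 0 = G₀ := by simp [hG]
  rw [h0, h0'] at h
  rw [← sub_eq_iff_eq_add', ← h]
  refine intervalIntegral.integral_congr_ae ?_
  filter_upwards [hFd, hGd] with t h1 h2 _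
  rw [h1, h2]

theorem integral_pow_succ_eq {φ : ℝ → ℝ} (hφ : LocallyIntegrable φ volume) (n : ℕ) (x : ℝ) :
    (∫ t in (0 : ℝ)..x, φ t) ^ (n + 1) =
      ∫ t in (0 : ℝ)..x, (n + 1) * (φ t * (∫ s in (0 : ℝ)..t, φ s) ^ n) := by
  induction n generalizing x with
  | zero => simp
  | succ n ih =>
    have hc := continuous_primitive_of_locallyIntegrable hφ
    have hl : LocallyIntegrable
        (fun t => (n + 1 : ℝ) * (φ t * (∫ s in (0 : ℝ)..t, φ s) ^ n)) volume :=
      (locallyIntegrable_mul_continuous hφ (hc.pow n)).smul (n + 1 : ℝ)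
    have h := mul_eq_add_integral_of_eq_add_integral (F₀ := 0) (G₀ := 0) hl hφ
      (F := fun x => (∫ t in (0 : ℝ)..x, φ t) ^ (n + 1)) (G := fun x => ∫ t in (0 : ℝ)..x, φ t)
      (fun x => by rw [zero_add]; exact ih x) (fun x => (zero_add _).symm) x
    rw [pow_succ, h, mul_zero, zero_add]
    refine intervalIntegral.integral_congr fun t _ => ?_
    push_cast
    ring

theorem abs_iterPrim_le {f g : ℝ → ℝ} (hf : LocallyIntegrable f volume)
    (hg : LocallyIntegrable g volume) (n : ℕ) (x : ℝ) :
    |iterPrim f g n x| ≤ |∫ t in (0 : ℝ)..x, (|f t| + |g t|)| ^ n / n.factorial := by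
  induction n generalizing x with
  | zero => simp [iterPrim]
  | succ n ih =>
    set φ : ℝ → ℝ := fun t => |f t| + |g t| with hφ_def
    have hφ0 : ∀ t, 0 ≤ φ t := fun t => by positivity
    have hφ : LocallyIntegrable φ volume := (locallyIntegrable_abs hf).add (locallyIntegrable_abs hg)
    set Ψ : ℝ → ℝ := fun x => ∫ t in (0 : ℝ)..x, φ t with hΨ_def
    have hΨ : Continuous Ψ := continuous_primitive_of_locallyIntegrable hφ
    have hpow : Ψ x ^ (n + 1) = (n + 1) * ∫ t in (0 : ℝ)..x, φ t * Ψ t ^ n := by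
      rw [← intervalIntegral.integral_const_mul]
      exact integral_pow_succ_eq hφ n x
    have habs : |∫ t in (0 : ℝ)..x, φ t * |Ψ t| ^ n| = |∫ t in (0 : ℝ)..x, φ t * Ψ t ^ n| := by
      rcases le_total 0 x with hx | hx
      · congr 1
        refine intervalIntegral.integral_congr fun t ht => ?_
        rw [uIcc_of_le hx] at ht
        have : 0 ≤ Ψ t := intervalIntegral.integral_nonneg ht.1 fun s _ => hφ0 s
        simp only [abs_of_nonneg this]
      · have : ∫ t in (0 : ℝ)..x, φ t * |Ψ t| ^ n =
            (-1) ^ n * ∫ t in (0 : ℝ)..x, φ t * Ψ t ^ n := by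
          rw [← intervalIntegral.integral_const_mul]
          refine intervalIntegral.integral_congr fun t ht => ?_
          rw [uIcc_of_ge hx] at ht
          have : Ψ t ≤ 0 := by
            rw [hΨ_def]
            simp only
            rw [intervalIntegral.integral_symm, neg_nonpos]
            exact intervalIntegral.integral_nonneg ht.2 fun s _ => hφ0 s
          simp only [abs_of_nonpos this, neg_pow (Ψ t)]
          ring
        rw [this, abs_mul]
        simp
    have hle : |iterPrim f g (n + 1) x| ≤
        |∫ t in (0 : ℝ)..x, φ t * |Ψ t| ^ n * (n.factorial : ℝ)⁻¹| := by
      rw [← Real.norm_eq_abs, iterPrim]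
      refine intervalIntegral.norm_integral_le_abs_of_norm_le (Eventually.of_forall fun t => ?_) ?_
      · rw [norm_mul, mul_assoc, ← div_eq_mul_inv]
        refine mul_le_mul ?_ (ih t) (norm_nonneg _) (hφ0 t)
        split_ifs
        · exact le_add_of_nonneg_right (abs_nonneg _)
        · exact le_add_of_nonneg_left (abs_nonneg _)
      · refine locallyIntegrable_intervalIntegrable ?_ _ _
        exact locallyIntegrable_mul_continuous
          (locallyIntegrable_mul_continuous hφ (hΨ.abs.pow n)) continuous_const
    refine hle.trans_eq ?_
    rw [intervalIntegral.integral_mul_const, abs_mul, habs, ← abs_pow]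
    change _ = |Ψ x ^ (n + 1)| / _
    rw [hpow, abs_mul, Nat.factorial_succ, abs_of_nonneg (by positivity : (0 : ℝ) ≤ n + 1),
      abs_of_nonneg (by positivity : (0 : ℝ) ≤ (n.factorial : ℝ)⁻¹)]
    push_cast
    field_simp

theorem exists_abs_iterPrim_le {f g : ℝ → ℝ} (hf : LocallyIntegrable f volume)
    (hg : LocallyIntegrable g volume) {K : Set ℝ} (hK : IsCompact K) :
    ∃ M : ℝ, ∀ n, ∀ t ∈ K, |iterPrim f g n t| ≤ M ^ n / n.factorial := by
  have hc : Continuous fun x => ∫ t in (0 : ℝ)..x, (|f t| + |g t|) :=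
    continuous_primitive_of_locallyIntegrable ((locallyIntegrable_abs hf).add
      (locallyIntegrable_abs hg))
  obtain ⟨M, hM⟩ := hK.exists_bound_of_continuousOn hc.continuousOn
  refine ⟨M, fun n t ht => (abs_iterPrim_le hf hg n t).trans ?_⟩
  gcongr
  exact hM t ht

theorem summable_iterPrim {f g : ℝ → ℝ} (hf : LocallyIntegrable f volume)
    (hg : LocallyIntegrable g volume) (x : ℝ) : Summable fun n => iterPrim f g n x := by
  obtain ⟨M, hM⟩ := exists_abs_iterPrim_le hf hg (isCompact_singleton (x := x))
  exact .of_norm_bounded (Real.summable_pow_div_factorial M) fun n => hM n x rfl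

theorem continuous_tsum_iterPrim {f g : ℝ → ℝ} (hf : LocallyIntegrable f volume)
    (hg : LocallyIntegrable g volume) {m : ℕ → ℕ} (hm : Function.Injective m) :
    Continuous fun x => ∑' k, iterPrim f g (m k) x := by
  refine continuous_iff_continuousAt.2 fun x => ?_
  obtain ⟨M, hM⟩ := exists_abs_iterPrim_le hf hg (isCompact_Icc (a := x - 1) (b := x + 1))
  have hs : Summable fun k => M ^ m k / (m k).factorial :=
    (Real.summable_pow_div_factorial M).comp_injective hm
  exact (continuousOn_tsum (fun k => (continuous_iterPrim hf hg (m k)).continuousOn) hs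
    fun k t ht => hM (m k) t ht).continuousAt (Icc_mem_nhds (by linarith) (by linarith))

theorem hasSum_integral_mul_iterPrim {f g u : ℝ → ℝ} (hf : LocallyIntegrable f volume)
    (hg : LocallyIntegrable g volume) (hu : LocallyIntegrable u volume) {m : ℕ → ℕ}
    (hm : Function.Injective m) (x : ℝ) :
    HasSum (fun k => ∫ t in (0 : ℝ)..x, u t * iterPrim f g (m k) t)
      (∫ t in (0 : ℝ)..x, u t * ∑' k, iterPrim f g (m k) t) := by
  obtain ⟨M, hM⟩ := exists_abs_iterPrim_le hf hg (isCompact_uIcc (a := 0) (b := x))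
  have hs : Summable fun k => M ^ m k / (m k).factorial :=
    (Real.summable_pow_div_factorial M).comp_injective hm
  refine intervalIntegral.hasSum_integral_of_dominated_convergence
    (fun k t => |u t| * (M ^ m k / (m k).factorial)) (fun k => ?_) (fun k => ?_) ?_ ?_ ?_
  · exact (locallyIntegrable_mul_continuous hu (continuous_iterPrim hf hg _)
      ).aestronglyMeasurable.restrict
  · refine Eventually.of_forall fun t ht => ?_
    rw [norm_mul]
    exact mul_le_mul_of_nonneg_left (hM _ t (uIoc_subset_uIcc ht)) (norm_nonneg _)
  · exact Eventually.of_forall fun t _ => hs.mul_left _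
  · simp only [tsum_mul_left]
    exact (locallyIntegrable_intervalIntegrable (locallyIntegrable_abs hu) 0 x).mul_const _
  · exact Eventually.of_forall fun t _ =>
      ((summable_iterPrim hf hg t).comp_injective hm).hasSum.mul_left _

/-- The sum of the iterated primitives of even order. -/
noncomputable def evenPrim (f g : ℝ → ℝ) (x : ℝ) : ℝ := ∑' k, iterPrim f g (2 * k) x

/-- The sum of the iterated primitives of odd order. -/
noncomputable def oddPrim (f g : ℝ → ℝ) (x : ℝ) : ℝ := ∑' k, iterPrim f g (2 * k + 1) x

section
variable {f g : ℝ → ℝ}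

theorem hasSum_evenPrim (hf : LocallyIntegrable f volume) (hg : LocallyIntegrable g volume)
    (x : ℝ) : HasSum (fun k => iterPrim f g (2 * k) x) (evenPrim f g x) :=
  ((summable_iterPrim hf hg x).comp_injective fun a b h => by simpa using h).hasSum

theorem hasSum_oddPrim (hf : LocallyIntegrable f volume) (hg : LocallyIntegrable g volume)
    (x : ℝ) : HasSum (fun k => iterPrim f g (2 * k + 1) x) (oddPrim f g x) := by
  have hi : Function.Injective fun k : ℕ => 2 * k + 1 := fun a b h => by simpa using h
  have hs : Summable fun k => iterPrim f g (2 * k + 1) x :=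
    (summable_iterPrim hf hg x).comp_injective hi
  exact hs.hasSum

theorem continuous_evenPrim (hf : LocallyIntegrable f volume)
    (hg : LocallyIntegrable g volume) : Continuous (evenPrim f g) :=
  continuous_tsum_iterPrim hf hg (m := fun k => 2 * k) fun a b h => by simpa using h

theorem continuous_oddPrim (hf : LocallyIntegrable f volume)
    (hg : LocallyIntegrable g volume) : Continuous (oddPrim f g) :=
  continuous_tsum_iterPrim hf hg (m := fun k => 2 * k + 1) fun a b h => by simpa using h

theorem oddPrim_eq_integral (hf : LocallyIntegrable f volume) (hg : LocallyIntegrable g volume)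
    (x : ℝ) : oddPrim f g x = ∫ t in (0 : ℝ)..x, f t * evenPrim f g t := by
  refine (hasSum_oddPrim hf hg x).unique ?_
  convert! hasSum_integral_mul_iterPrim hf hg hf (m := fun k => 2 * k)
    (fun a b h => by simpa using h) x using 3 with k
  simp [iterPrim]

theorem evenPrim_eq_integral (hf : LocallyIntegrable f volume) (hg : LocallyIntegrable g volume)
    (x : ℝ) : evenPrim f g x = 1 + ∫ t in (0 : ℝ)..x, g t * oddPrim f g t := by
  refine (hasSum_evenPrim hf hg x).unique ?_
  rw [← hasSum_nat_add_iff' 1]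
  convert! hasSum_integral_mul_iterPrim hf hg hg (m := fun k => 2 * k + 1)
    (fun a b h => by simpa using h) x using 3 with k
  · rw [mul_add, mul_one, iterPrim]
    simp [Nat.add_mod]
  · simp [iterPrim, oddPrim]

theorem bivE_ofReal (hf : LocallyIntegrable f volume) (hg : LocallyIntegrable g volume) (x : ℝ) :
    bivE (fun t => (f t : ℂ)) (fun t => (g t : ℂ)) x = evenPrim f g x + oddPrim f g x := by
  simp only [bivE, simplexA_ofReal hf hg]
  have h : HasSum (fun n => iterPrim f g n x) (evenPrim f g x + oddPrim f g x) :=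
    (hasSum_evenPrim hf hg x).even_add_odd (hasSum_oddPrim hf hg x)
  have h0 : iterPrim f g 0 x = 1 := rfl
  rw [← Complex.ofReal_tsum, ← Complex.ofReal_add, ← h.tsum_eq,
    (summable_iterPrim hf hg x).tsum_eq_zero_add, h0, Complex.ofReal_add, Complex.ofReal_one]

theorem bivE_neg_ofReal (hf : LocallyIntegrable f volume) (hg : LocallyIntegrable g volume)
    (x : ℝ) : bivE (-fun t => (f t : ℂ)) (-fun t => (g t : ℂ)) x =
      evenPrim f g x - oddPrim f g x := by
  have h := bivE_ofReal hf.neg hg.neg x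
  have he : evenPrim (-f) (-g) x = evenPrim f g x := by simp [evenPrim, iterPrim_neg]
  have ho : oddPrim (-f) (-g) x = -oddPrim f g x := by
    simp [oddPrim, iterPrim_neg, pow_succ, tsum_neg]
  rw [he, ho] at h
  convert! h using 1
  · congr <;> ext t <;> simp
  · push_cast
    ring

theorem bivC_ofReal (hf : LocallyIntegrable f volume) (hg : LocallyIntegrable g volume) (x : ℝ) :
    bivC (fun t => (f t : ℂ)) (fun t => (g t : ℂ)) x = evenPrim f g x := by
  rw [bivC, bivE_ofReal hf hg, bivE_neg_ofReal hf hg]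
  ring

theorem bivS_ofReal (hf : LocallyIntegrable f volume) (hg : LocallyIntegrable g volume) (x : ℝ) :
    bivS (fun t => (f t : ℂ)) (fun t => (g t : ℂ)) x = oddPrim f g x := by
  rw [bivS, bivE_ofReal hf hg, bivE_neg_ofReal hf hg]
  ring

theorem evenPrim_mul_sub_oddPrim_mul (hf : LocallyIntegrable f volume)
    (hg : LocallyIntegrable g volume) (x : ℝ) :
    evenPrim f g x * evenPrim g f x - oddPrim g f x * oddPrim f g x = 1 := by
  have h1 := mul_eq_add_integral_of_eq_add_integral
    (locallyIntegrable_mul_continuous hg (continuous_oddPrim hf hg))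
    (locallyIntegrable_mul_continuous hf (continuous_oddPrim hg hf))
    (evenPrim_eq_integral hf hg) (evenPrim_eq_integral hg hf) x
  have h2 := mul_eq_add_integral_of_eq_add_integral (F₀ := 0) (G₀ := 0)
    (F := oddPrim g f) (G := oddPrim f g)
    (locallyIntegrable_mul_continuous hg (continuous_evenPrim hg hf))
    (locallyIntegrable_mul_continuous hf (continuous_evenPrim hf hg))
    (fun x => by rw [zero_add, oddPrim_eq_integral hg hf])
    (fun x => by rw [zero_add, oddPrim_eq_integral hf hg]) x
  rw [h1, h2, mul_one, mul_zero, zero_add, sub_eq_iff_eq_add]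
  congr 1
  refine intervalIntegral.integral_congr fun t _ => ?_
  ring

end

theorem ordConnected_setOf_forall_mul_add_ne_zero {c d : ℝ → ℝ} (hc : Continuous c)
    (hd : Continuous d) (hc0 : c 0 = 0) (hd0 : d 0 = 1) :
    {t : ℝ | ∀ x, t * c x + d x ≠ 0}.OrdConnected := by
  have hpos : ∀ t : ℝ, (∀ x, t * c x + d x ≠ 0) → ∀ x, 0 < t * c x + d x := by
    intro t ht x
    by_contra! hx
    obtain ⟨y, hy⟩ := mem_range_of_exists_le_of_exists_ge
      (((continuous_const (y := t)).mul hc).add hd) ⟨x, hx⟩ ⟨0, by simp [hc0, hd0]⟩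
    exact ht y hy
  refine ⟨fun s hs t ht r hr x => ?_⟩
  have h1 := hpos s hs x
  have h2 := hpos t ht x
  rcases le_total 0 (c x) with h | h
  · nlinarith [mul_le_mul_of_nonneg_right hr.1 h]
  · nlinarith [mul_le_mul_of_nonpos_right hr.2 h]

end

theorem miura_singular_curve (q : ℝ → ℝ) (hq : LocallyIntegrable q volume)
    (qc one : ℝ → ℂ) (hqc : qc = fun x => (q x : ℂ)) (hone : one = fun _ => 1)
    (c d : ℝ → ℂ) (hc : c = bivS one qc) (hd : d = bivC qc one)
    (Sig : Set ℂ) (hSig : Sig = {z : ℂ | ∃ x : ℝ, c x ≠ 0 ∧ z = -d x / c x})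
    (Sigr : Set ℝ) (hSigr : Sigr = {t : ℝ | ∃ x : ℝ, c x ≠ 0 ∧ (t : ℂ) = -d x / c x}) :
    (∀ z ∈ Sig, ∃ t : ℝ, z = (t : ℂ)) ∧
    (Sigr ≠ Set.univ → (Set.univ \ Sigr).OrdConnected) := by
  have hone_int : LocallyIntegrable (fun _ : ℝ => (1 : ℝ)) volume := locallyIntegrable_const 1
  have hcr : ∀ x, c x = oddPrim (fun _ => 1) q x := fun x => by
    rw [hc, hone, hqc, ← bivS_ofReal hone_int hq, Complex.ofReal_one]
  have hdr : ∀ x, d x = evenPrim q (fun _ => 1) x := fun x => by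
    rw [hd, hone, hqc, ← bivC_ofReal hq hone_int, Complex.ofReal_one]
  refine ⟨fun z hz => ?_, fun _ => ?_⟩
  · rw [hSig] at hz
    obtain ⟨x, -, rfl⟩ := hz
    exact ⟨-evenPrim q (fun _ => 1) x / oddPrim (fun _ => 1) q x, by rw [hcr, hdr]; push_cast; rfl⟩
  · have hset : Set.univ \ Sigr =
        {t : ℝ | ∀ x, t * oddPrim (fun _ => 1) q x + evenPrim q (fun _ => 1) x ≠ 0} := by
      ext t
      simp only [hSigr, hcr, hdr, Set.mem_sdiff, Set.mem_univ, true_and, Set.mem_ofPred_eq,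
        not_exists, not_and]
      refine forall_congr' fun x => ?_
      norm_cast
      have hdet := evenPrim_mul_sub_oddPrim_mul hone_int hq x
      by_cases h : oddPrim (fun _ => 1) q x = 0
      · simp only [h, not_true_eq_false, false_imp_iff, true_iff, mul_zero, zero_add]
        intro h'
        simp [h, h'] at hdet
      · rw [eq_div_iff h, eq_neg_iff_add_eq_zero]
        simp [h]
    rw [hset]
    refine ordConnected_setOf_forall_mul_add_ne_zero (continuous_oddPrim hone_int hq)
      (continuous_evenPrim hq hone_int) ?_ ?_
    · simp [oddPrim_eq_integral hone_int hq]
    · simp [evenPrim_eq_integral hq hone_int]
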